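/- Let u be an internal node of T. Then every node v in the left subtree L_u satisfies A_d(v) > B − 2·s_u, and every node v in the right subtree R_u satisfies A_d(v) ≤ B − 4·s_u. -/

import Mathlib

namespace StocOrient

/-- State along a root-to-node walk in the tree `T`:
current node's size `sz`, residual budget `bu`, distance traveled `dist`
(i.e. `A_d`), and size instantiated `inst` (i.e. `A_s`). -/
structure St where
  sz : ℚ
  bu : ℚ
  dist : ℚ
  inst : ℚ

/-- One step from a node at level `lvl` to one of its children
(`true` = right child, `false` = left child); the child is at level `lvl - 1`. -/
def step (lvl : ℕ) (x : St) (dir : Bool) : St :=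
  if dir then
    { sz := x.sz * (2 : ℚ) ^ ((2 : ℤ) ^ (lvl - 1)),
      bu := x.bu - x.sz,
      dist := x.dist,
      inst := x.inst + x.sz }
  else
    { sz := x.sz * (2 : ℚ) ^ (-((2 : ℤ) ^ (lvl - 1))),
      bu := x.sz,
      dist := x.dist + (x.bu - x.sz),
      inst := x.inst }

def walkAux : ℕ → St → List Bool → St
  | _, x, [] => x
  | lvl, x, d :: rest => walkAux (lvl - 1) (step lvl x d) rest

/-- The budget `B = 2^(2^(L+1))`. -/
def Bq (L : ℕ) : ℚ := 2 ^ 2 ^ (L + 1)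

/-- Data at the root: `s_ρ = 2^(2^L)`, `b(ρ) = B`, `A_d(ρ) = A_s(ρ) = 0`. -/
def start (L : ℕ) : St := ⟨2 ^ 2 ^ L, Bq L, 0, 0⟩

/-- A node of the tree `T` is identified with its root-to-node path
(`true` = right branch); nodes of `T` are exactly the paths of length `< L`. -/
def walk (L : ℕ) (v : List Bool) : St := walkAux L (start L) v

/-- The size `s_v`. -/
def size (L : ℕ) (v : List Bool) : ℚ := (walk L v).sz

/-- The residual budget `b(v)`. -/
def budget (L : ℕ) (v : List Bool) : ℚ := (walk L v).bu

/-- `A_d(v)`: total edge length on the root-to-`v` path. -/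
def Ad (L : ℕ) (v : List Bool) : ℚ := (walk L v).dist

/-- `A_s(v)`: total size of strict ancestors of `v` from which the path to `v`
goes right. -/
def As (L : ℕ) (v : List Bool) : ℚ := (walk L v).inst

/-- The level `ℓ(v)`: the root is at level `L`, the leaves at level `1`. -/
def level (L : ℕ) (v : List Bool) : ℕ := L - v.length

end StocOrient

open StocOrient

namespace StocOrient

/-- The invariants of the walk at level `n`, in terms of the total budget `B`. -/
structure Invariants (B : ℚ) (n : ℕ) (x : St) : Prop where
  sz_pos : 0 < x.sz
  inst_nonneg : 0 ≤ x.inst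
  inst_le : ((2 : ℚ) ^ 2 ^ n - 1) * x.inst ≤ x.sz
  le_bu : ((2 : ℚ) ^ 2 ^ n - 1) * x.sz ≤ x.bu
  total : x.dist + x.inst + x.bu = B

lemma step_true (n : ℕ) (x : St) :
    step (n + 1) x true = ⟨x.sz * 2 ^ 2 ^ n, x.bu - x.sz, x.dist, x.inst + x.sz⟩ := by
  have h : (2 : ℚ) ^ ((2 : ℤ) ^ n) = 2 ^ 2 ^ n := by
    rw [← zpow_natCast]; push_cast; rfl
  simp [step, h]

lemma step_false (n : ℕ) (x : St) :
    step (n + 1) x false = ⟨x.sz / 2 ^ 2 ^ n, x.sz, x.dist + (x.bu - x.sz), x.inst⟩ := by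
  have h : (2 : ℚ) ^ ((2 : ℤ) ^ n) = 2 ^ 2 ^ n := by
    rw [← zpow_natCast]; push_cast; rfl
  simp [step, zpow_neg, h, div_eq_mul_inv]

lemma two_pow_two_pow_succ (n : ℕ) : (2 : ℚ) ^ 2 ^ (n + 1) = (2 ^ 2 ^ n) ^ 2 := by
  rw [← pow_mul, ← pow_succ]

lemma two_le_two_pow_two_pow (n : ℕ) : (2 : ℚ) ≤ 2 ^ 2 ^ n :=
  le_self_pow₀ (by norm_num) (by positivity)

lemma four_le_two_pow_two_pow {n : ℕ} (hn : 1 ≤ n) : (4 : ℚ) ≤ 2 ^ 2 ^ n := by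
  obtain ⟨k, rfl⟩ := Nat.exists_eq_add_of_le' hn
  rw [two_pow_two_pow_succ]
  nlinarith [two_le_two_pow_two_pow k]

lemma Invariants.step {B : ℚ} {n : ℕ} {x : St} (h : Invariants B (n + 1) x) (d : Bool) :
    Invariants B n (step (n + 1) x d) := by
  obtain ⟨hs, hi, his, hb, ht⟩ := h
  rw [two_pow_two_pow_succ] at his hb
  have hm := two_le_two_pow_two_pow n
  have hm0 : (0 : ℚ) < 2 ^ 2 ^ n := by positivity
  cases d
  · rw [step_false]
    refine ⟨div_pos hs hm0, hi, ?_, ?_, by simp only; linarith⟩ <;> simp only <;>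
      generalize (2 : ℚ) ^ 2 ^ n = m at *
    · rw [le_div_iff₀ hm0]
      nlinarith
    · rw [← mul_div_assoc, div_le_iff₀ hm0]
      nlinarith
  · rw [step_true]
    refine ⟨mul_pos hs hm0, by simp only; linarith, ?_, ?_, by simp only; linarith⟩ <;>
      simp only <;> generalize (2 : ℚ) ^ 2 ^ n = m at *
    · have h1 : (m + 1) * ((m - 1) * (x.inst + x.sz)) ≤ (m + 1) * (x.sz * m) := by
        nlinarith
      exact le_of_mul_le_mul_left h1 (by linarith)
    · nlinarith

lemma Invariants.dist_le_step {B : ℚ} {n : ℕ} {x : St} (h : Invariants B (n + 1) x)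
    (d : Bool) : x.dist ≤ (StocOrient.step (n + 1) x d).dist := by
  cases d
  · have hm := four_le_two_pow_two_pow (n := n + 1) (by omega)
    have hb := h.le_bu
    rw [step_false]
    simp only
    nlinarith [h.sz_pos]
  · rw [step_true]

lemma mul_le_step_sz {c : ℚ} {n : ℕ} {x : St} (hx : 0 < x.sz)
    (h : c * 2 ^ 2 ^ (n + 1) ≤ x.sz) (d : Bool) :
    c * 2 ^ 2 ^ n ≤ (step (n + 1) x d).sz := by
  have hm := two_le_two_pow_two_pow n
  rw [two_pow_two_pow_succ] at h
  cases d
  · rw [step_false]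
    generalize (2 : ℚ) ^ 2 ^ n = m at *
    rw [le_div_iff₀ (by linarith)]
    linarith
  · rw [step_true]
    generalize (2 : ℚ) ^ 2 ^ n = m at *
    have hm0 : 0 < m := by linarith
    refine mul_le_mul_of_nonneg_right ?_ hm0.le
    by_contra! hc
    have h1 : c * 1 ≤ c * m ^ 2 :=
      mul_le_mul_of_nonneg_left (by nlinarith) (by linarith)
    linarith

lemma walkAux_induction {P : ℕ → St → Prop}
    (hP : ∀ n x d, P (n + 1) x → P n (step (n + 1) x d)) (v : List Bool) :
    ∀ (n : ℕ) (x : St), v.length ≤ n → P n x → P (n - v.length) (walkAux n x v) := by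
  induction v with
  | nil => intro n x _ h; simpa [walkAux] using h
  | cons d v ih =>
    intro n x hn h
    rw [List.length_cons] at hn
    obtain ⟨k, rfl⟩ := Nat.exists_eq_add_of_le' (show 1 ≤ n by omega)
    have := ih k _ (by omega) (hP k x d h)
    simpa [walkAux] using this

lemma walkAux_append (v w : List Bool) :
    ∀ (n : ℕ) (x : St), walkAux n x (v ++ w) = walkAux (n - v.length) (walkAux n x v) w := by
  induction v with
  | nil => simp [walkAux]
  | cons d v ih => intro n x; simp [walkAux, ih, Nat.sub_sub, Nat.add_comm]

lemma invariants_start (L : ℕ) : Invariants (Bq L) L (start L) := by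
  refine ⟨by simp [start], by simp [start], by simp [start], ?_, by simp [start]⟩
  simp only [start, Bq, two_pow_two_pow_succ]
  nlinarith [two_le_two_pow_two_pow L]

lemma invariants_walk {L : ℕ} {v : List Bool} (hv : v.length ≤ L) :
    Invariants (Bq L) (L - v.length) (walk L v) :=
  walkAux_induction (fun _ _ d h => h.step d) v L _ hv (invariants_start L)

end StocOrient

/-- For an internal node `u`: every node `v` in the left subtree `L_u`
satisfies `A_d(v) > B - 2·s_u`, and every node `v` in the right subtree
`R_u` satisfies `A_d(v) ≤ B - 4·s_u`. -/
theorem stmt12 (L : ℕ) (hL : 2 ≤ L) (u : List Bool) (hu : u.length + 1 < L) :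
    (∀ v : List Bool, v.length < L → (u ++ [false]) <+: v →
      Bq L - 2 * size L u < Ad L v) ∧
    (∀ v : List Bool, v.length < L → (u ++ [true]) <+: v →
      Ad L v ≤ Bq L - 4 * size L u) := by
  obtain ⟨n, hn⟩ : ∃ n, L - u.length = n + 1 := ⟨L - u.length - 1, by omega⟩
  have hI := invariants_walk (L := L) (v := u) (by omega)
  rw [hn] at hI
  have hwalk (d : Bool) (w : List Bool) :
      walk L (u ++ [d] ++ w) = walkAux n (step (n + 1) (walk L u) d) w := by
    simp [walk, walkAux_append, walkAux, hn]
  constructor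
  · rintro _ hv ⟨w, rfl⟩
    simp only [List.length_append, List.length_singleton] at hv
    have hd := (walkAux_induction
      (P := fun k x => Invariants (Bq L) k x ∧ (step (n + 1) (walk L u) false).dist ≤ x.dist)
      (fun _ _ d h => ⟨h.1.step d, h.2.trans (h.1.dist_le_step d)⟩) w n _ (by omega)
      ⟨hI.step false, le_rfl⟩).2
    rw [← hwalk, step_false] at hd
    have hm := four_le_two_pow_two_pow (n := n + 1) (by omega)
    have his := hI.inst_le
    have ht := hI.total
    rw [Ad, size]
    simp only at hd
    nlinarith [hI.sz_pos, hI.inst_nonneg]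
  · rintro _ hv ⟨w, rfl⟩
    simp only [List.length_append, List.length_singleton] at hv
    obtain ⟨hJ, hs⟩ := walkAux_induction
      (P := fun k x => Invariants (Bq L) k x ∧ size L u * 2 ^ 2 ^ k ≤ x.sz)
      (fun _ _ d h => ⟨h.1.step d, mul_le_step_sz h.1.sz_pos h.2 d⟩) w n
      (step (n + 1) (walk L u) true) (by omega) ⟨hI.step true, by rw [step_true, size]⟩
    rw [← hwalk] at hJ hs
    have hm := four_le_two_pow_two_pow (n := n - w.length) (by omega)
    have hu0 : 0 < size L u := hI.sz_pos
    have hb := hJ.le_bu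
    have hs4 : 4 * size L u ≤ (walk L (u ++ [true] ++ w)).sz := by nlinarith
    rw [Ad]
    nlinarith [hJ.total, hJ.inst_nonneg, hJ.sz_pos]
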